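/- arXiv:2411.01721 — 4 statements merged into one kernel-verified Lean document; each statement's English description precedes it below -/
import Mathlib

section
/- There exists an absolute constant c > 0 such that the following holds. For every n ≥ 1, every 0 ≤ ε ≤ c/n³, and all distinct nonempty S, S' ⊆ [n] with associated high-precision games (R^S, C^S) and (R^{S'}, C^{S'}): for all integers T, T' ≥ 1, any uniform T-sparse ε-CCE μ of (R^S, C^S) and any uniform T'-sparse ε-CCE μ' of (R^{S'}, C^{S'}) satisfy μ ≠ μ' (as distributions on [n]×[n]). -/
open Finset Matrix

noncomputable section

/-- The probability simplex Δⁿ on `Fin n`. -/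
def simplex (n : ℕ) : Set (Fin n → ℝ) :=
  {x | (∀ i, 0 ≤ x i) ∧ ∑ i, x i = 1}

/-- The linear action of a deviation `φ : [n] → [n]` on vectors:
`(φ(x))_{i'} = ∑_{i : φ(i) = i'} x_i`. -/
def devApply {n : ℕ} (φ : Fin n → Fin n) (x : Fin n → ℝ) : Fin n → ℝ :=
  fun i' => ∑ i, if φ i = i' then x i else 0

/-- The deviation set Φ: either `φ(i) = i'` for all `i ≤ i₀` and `φ(i) = i` for `i > i₀`,
or `φ` is an internal deviation (identity on all but at most one point). -/
def InPhi {n : ℕ} (φ : Fin n → Fin n) : Prop :=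
  (∃ i' i₀ : Fin n, ∀ i, (i ≤ i₀ → φ i = i') ∧ (i₀ < i → φ i = i)) ∨
  (∃ i₀ : Fin n, ∀ i, i ≠ i₀ → φ i = i)

/-- `μ = (1/T) ∑_t x^{(t)} ⊗ y^{(t)}` is a uniform `T`-sparse `ε`-CE of `(R, C)`. -/
def IsSparseCE {n : ℕ} (R C : Matrix (Fin n) (Fin n) ℝ) (T : ℕ)
    (x y : Fin T → Fin n → ℝ) (ε : ℝ) : Prop :=
  ∀ φx φy : Fin n → Fin n, InPhi φx → InPhi φy →
    (1 / (T : ℝ)) * ∑ t, x t ⬝ᵥ R.mulVec (y t) ≥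
      (1 / (T : ℝ)) * ∑ t, devApply φx (x t) ⬝ᵥ R.mulVec (y t) - ε ∧
    (1 / (T : ℝ)) * ∑ t, x t ⬝ᵥ C.mulVec (y t) ≥
      (1 / (T : ℝ)) * ∑ t, x t ⬝ᵥ C.mulVec (devApply φy (y t)) - ε

/-- `μ = (1/T) ∑_t x^{(t)} ⊗ y^{(t)}` is a uniform `T`-sparse `ε`-CCE of `(R, C)`. -/
def IsSparseCCE {n : ℕ} (R C : Matrix (Fin n) (Fin n) ℝ) (T : ℕ)
    (x y : Fin T → Fin n → ℝ) (ε : ℝ) : Prop :=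
  (∀ x' ∈ simplex n,
    (1 / (T : ℝ)) * ∑ t, x t ⬝ᵥ R.mulVec (y t) ≥
      (1 / (T : ℝ)) * ∑ t, x' ⬝ᵥ R.mulVec (y t) - ε) ∧
  (∀ y' ∈ simplex n,
    (1 / (T : ℝ)) * ∑ t, x t ⬝ᵥ C.mulVec (y t) ≥
      (1 / (T : ℝ)) * ∑ t, x t ⬝ᵥ C.mulVec y' - ε)

/-- `(x, y)` is an `ε`-Nash equilibrium of `(R, C)`. -/
def IsNash {n : ℕ} (R C : Matrix (Fin n) (Fin n) ℝ) (x y : Fin n → ℝ) (ε : ℝ) : Prop :=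
  (∀ x' ∈ simplex n, x ⬝ᵥ R.mulVec y ≥ x' ⬝ᵥ R.mulVec y - ε) ∧
  (∀ y' ∈ simplex n, x ⬝ᵥ C.mulVec y ≥ x ⬝ᵥ C.mulVec y' - ε)

/-- The uniform distribution `u(S)` over a subset `S ⊆ [n]`. -/
def unif {n : ℕ} (S : Finset (Fin n)) : Fin n → ℝ :=
  fun i => if i ∈ S then (S.card : ℝ)⁻¹ else 0

/-- Embedding of the first `n` actions into `[2n]`. -/
def finL {n : ℕ} (i : Fin n) : Fin (2 * n) := ⟨(i : ℕ), by have := i.isLt; omega⟩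

/-- Embedding of the last `n` actions into `[2n]`. -/
def finR {n : ℕ} (i : Fin n) : Fin (2 * n) := ⟨n + (i : ℕ), by have := i.isLt; omega⟩

/-- Row player's payoff matrix of the high-precision game associated with a nonempty
`S ⊆ [n]` (`m = |S|`): `−1` if `i ∉ S`; `1/2` if `i ∈ S, j ∉ S`; and
`[i = j] + 1/2 − 1/m` if `i, j ∈ S`. -/
def HPR {n : ℕ} (S : Finset (Fin n)) : Matrix (Fin n) (Fin n) ℝ := fun i j =>
  if i ∈ S then
    (if j ∈ S then (if i = j then 1 else 0) + 1 / 2 - 1 / (S.card : ℝ) else 1 / 2)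
  else -1

/-- Column player's payoff matrix of the high-precision game: `−1` if `j ∉ S`; `1/2` if
`j ∈ S, i ∉ S`; and `−[i = j] + 1/2 + 1/m` if `i, j ∈ S`. -/
def HPC {n : ℕ} (S : Finset (Fin n)) : Matrix (Fin n) (Fin n) ℝ := fun i j =>
  if j ∈ S then
    (if i ∈ S then -(if i = j then 1 else 0) + 1 / 2 + 1 / (S.card : ℝ) else 1 / 2)
  else -1

lemma hp_sum {n : ℕ} (S : Finset (Fin n)) (x y : Fin n → ℝ) (hx : x ∈ simplex n)
    (hy : y ∈ simplex n) :
    x ⬝ᵥ (HPR S).mulVec y + x ⬝ᵥ (HPC S).mulVec y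
      = -2 + 3 / 2 * (∑ i ∈ S, x i) + 3 / 2 * (∑ j ∈ S, y j) := by
  have h : HPR S + HPC S = fun i j =>
      (-2 + 3 / 2 * (if i ∈ S then 1 else 0)) + 3 / 2 * (if j ∈ S then 1 else (0:ℝ)) := by
    ext i j
    simp only [Matrix.add_apply, HPR, HPC]
    split_ifs <;> ring
  rw [← dotProduct_add, ← Matrix.add_mulVec, h]
  have hy1 : ∀ i, Matrix.mulVec (fun (i j : Fin n) =>
      (-2 + 3 / 2 * (if i ∈ S then 1 else 0)) + 3 / 2 * (if j ∈ S then 1 else (0:ℝ))) y i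
      = (-2 + 3 / 2 * (if i ∈ S then 1 else 0)) + 3 / 2 * (∑ j ∈ S, y j) := by
    intro i
    simp only [Matrix.mulVec, dotProduct, add_mul _ _ (y _), Finset.sum_add_distrib]
    rw [← Finset.mul_sum, hy.2, mul_one]
    simp [← Finset.mul_sum, hy.2]
  simp only [dotProduct, hy1]
  have e : ∀ i, x i * ((-2 + 3 / 2 * (if i ∈ S then 1 else 0)) + 3 / 2 * (∑ j ∈ S, y j))
      = x i * (-2 + 3 / 2 * (∑ j ∈ S, y j)) + 3 / 2 * (if i ∈ S then x i else 0) := by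
    intro i
    split_ifs <;> ring
  simp only [e, Finset.sum_add_distrib]
  rw [← Finset.sum_mul, hx.2, ← Finset.mul_sum]
  simp
  ring

lemma unif_mem {n : ℕ} (S : Finset (Fin n)) (hS : S.Nonempty) : unif S ∈ simplex n := by
  have : (S.card : ℝ) ≠ 0 := by exact_mod_cast hS.card_pos.ne'
  refine ⟨fun i => ?_, ?_⟩
  · unfold unif; split_ifs <;> positivity
  · simp [unif, this]

lemma hp_R_unif {n : ℕ} (S : Finset (Fin n)) (hS : S.Nonempty) (y : Fin n → ℝ)
    (hy : y ∈ simplex n) : unif S ⬝ᵥ (HPR S).mulVec y = 1 / 2 := by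
  have hm : (S.card : ℝ) ≠ 0 := by exact_mod_cast hS.card_pos.ne'
  rw [Matrix.dotProduct_mulVec]
  have h : Matrix.vecMul (unif S) (HPR S) = fun _ => 1 / 2 := by
    ext j
    have e : ∀ i, unif S i * HPR S i j = if i ∈ S then (S.card : ℝ)⁻¹ *
        (1 / 2 - (if j ∈ S then 1 / (S.card : ℝ) else 0) + if i = j then (if j ∈ S then 1 else 0) else 0)
        else 0 := by
      intro i
      unfold unif HPR
      split_ifs <;> ring
    simp only [Matrix.vecMul, dotProduct, e]
    rw [Finset.sum_ite_mem, Finset.univ_inter, ← Finset.mul_sum, Finset.sum_add_distrib,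
      Finset.sum_const, nsmul_eq_mul, Finset.sum_ite_eq']
    split_ifs <;> field_simp <;> ring
  rw [h]
  simp only [dotProduct]
  rw [← Finset.mul_sum, hy.2, mul_one]

lemma hp_C_unif {n : ℕ} (S : Finset (Fin n)) (hS : S.Nonempty) (x : Fin n → ℝ)
    (hx : x ∈ simplex n) : x ⬝ᵥ (HPC S).mulVec (unif S) = 1 / 2 := by
  have hm : (S.card : ℝ) ≠ 0 := by exact_mod_cast hS.card_pos.ne'
  have h : Matrix.mulVec (HPC S) (unif S) = fun _ => 1 / 2 := by
    ext i
    have e : ∀ j, HPC S i j * unif S j = if j ∈ S then (S.card : ℝ)⁻¹ *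
        (1 / 2 + (if i ∈ S then 1 / (S.card : ℝ) else 0) - if i = j then (if i ∈ S then 1 else 0) else 0)
        else 0 := by
      intro j
      unfold unif HPC
      split_ifs <;> ring
    simp only [Matrix.mulVec, dotProduct, e]
    rw [Finset.sum_ite_mem, Finset.univ_inter, ← Finset.mul_sum, Finset.sum_sub_distrib,
      Finset.sum_const, nsmul_eq_mul, Finset.sum_ite_eq]
    split_ifs <;> field_simp <;> ring
  rw [h]
  simp only [dotProduct]
  rw [← Finset.sum_mul, hx.2, one_mul]

lemma hp_C_single {n : ℕ} (S : Finset (Fin n)) (x : Fin n → ℝ)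
    (hx : x ∈ simplex n) (j : Fin n) (hj : j ∈ S) :
    x ⬝ᵥ (HPC S).mulVec (Pi.single j 1) = 1 / 2 - x j + (∑ i ∈ S, x i) / S.card := by
  rw [Matrix.mulVec_single_one]
  have e : ∀ i, x i * (HPC S).col j i = x i * (1 / 2) - (if i = j then x i else 0)
      + (if i ∈ S then x i else 0) / S.card := by
    intro i
    simp only [Matrix.col_apply, HPC, hj, if_true]
    by_cases h : i = j
    · subst h
      simp only [hj, if_true]; ring
    · simp only [h, if_false]
      split_ifs <;> ring
  simp only [dotProduct, e]
  rw [Finset.sum_add_distrib, Finset.sum_sub_distrib, ← Finset.sum_mul, hx.2, ← Finset.sum_div]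
  simp

lemma hp_key {n : ℕ} (S : Finset (Fin n)) (hS : S.Nonempty) (ε : ℝ) (T : ℕ) (hT : 1 ≤ T)
    (x y : Fin T → Fin n → ℝ) (hx : ∀ t, x t ∈ simplex n) (hy : ∀ t, y t ∈ simplex n)
    (h : IsSparseCCE (HPR S) (HPC S) T x y ε)
    (a : Fin n → ℝ) (ha : ∀ i, a i = (1 / (T : ℝ)) * ∑ t, x t i) :
    a ∈ simplex n ∧ 1 - 4 / 3 * ε ≤ ∑ i ∈ S, a i ∧
      ∀ j ∈ S, (∑ i ∈ S, a i) / S.card - 2 * ε ≤ a j := by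
  have hT0 : (T : ℝ) ≠ 0 := by positivity
  have hT1 : (1 / (T : ℝ)) * T = 1 := by field_simp
  have hT2 : (0:ℝ) ≤ 1 / (T : ℝ) := by positivity
  have hA : ∑ i ∈ S, a i = (1 / (T : ℝ)) * ∑ t, ∑ i ∈ S, x t i := by
    simp only [ha, ← Finset.mul_sum]
    rw [Finset.sum_comm]
  have has : a ∈ simplex n := by
    refine ⟨fun i => ?_, ?_⟩
    · rw [ha]
      exact mul_nonneg hT2 (Finset.sum_nonneg fun t _ => (hx t).1 i)
    · simp only [ha, ← Finset.mul_sum]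
      rw [Finset.sum_comm, Finset.sum_congr rfl (fun t _ => (hx t).2)]
      simpa using hT1
  have hp1 : ∑ i ∈ S, a i ≤ 1 := by
    rw [← has.2]
    exact Finset.sum_le_univ_sum_of_nonneg has.1
  have hq1 : (1 / (T : ℝ)) * ∑ t, ∑ i ∈ S, y t i ≤ 1 := by
    have : ∑ t, ∑ i ∈ S, y t i ≤ ∑ t : Fin T, (1:ℝ) := by
      refine Finset.sum_le_sum fun t _ => ?_
      rw [← (hy t).2]
      exact Finset.sum_le_univ_sum_of_nonneg (hy t).1
    have h2 := mul_le_mul_of_nonneg_left this hT2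
    simp only [Finset.sum_const, Finset.card_univ, Fintype.card_fin, nsmul_eq_mul, mul_one, hT1] at h2
    exact h2
  have hc : ∀ r : ℝ, (1 / (T : ℝ)) * ∑ _t : Fin T, r = r := by
    intro r
    simp only [Finset.sum_const, Finset.card_univ, Fintype.card_fin, nsmul_eq_mul]
    rw [← mul_assoc, hT1, one_mul]
  have hR := h.1 _ (unif_mem S hS)
  have hC := h.2 _ (unif_mem S hS)
  rw [Finset.sum_congr rfl (fun t _ => hp_R_unif S hS (y t) (hy t)), hc] at hR
  rw [Finset.sum_congr rfl (fun t _ => hp_C_unif S hS (x t) (hx t)), hc] at hC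
  have hs : (1 / (T : ℝ)) * ∑ t, x t ⬝ᵥ (HPR S).mulVec (y t)
      + (1 / (T : ℝ)) * ∑ t, x t ⬝ᵥ (HPC S).mulVec (y t)
      = -2 + 3 / 2 * (∑ i ∈ S, a i) + 3 / 2 * ((1 / (T : ℝ)) * ∑ t, ∑ i ∈ S, y t i) := by
    rw [← mul_add, ← Finset.sum_add_distrib,
      Finset.sum_congr rfl (fun t _ => hp_sum S (x t) (y t) (hx t) (hy t)),
      Finset.sum_add_distrib, Finset.sum_add_distrib, mul_add, mul_add, hc, hA,
      ← Finset.mul_sum, ← Finset.mul_sum]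
    ring
  refine ⟨has, by linarith, fun j hj => ?_⟩
  have hmem : (Pi.single j 1 : Fin n → ℝ) ∈ simplex n := by
    refine ⟨fun i => ?_, by simp⟩
    by_cases hij : i = j
    · subst hij; simp
    · simp [hij]
  have hJ := h.2 _ hmem
  rw [Finset.sum_congr rfl (fun t _ => hp_C_single S (x t) (hx t) j hj),
    Finset.sum_add_distrib, Finset.sum_sub_distrib, mul_add, mul_sub, hc, ← Finset.sum_div,
    ← mul_div_assoc, ← hA, ← ha] at hJ
  linarith

lemma hp_sub {n : ℕ} (ε : ℝ) (hn : 1 ≤ n) (hε : 0 ≤ ε) (h : ε ≤ 1 / 10 / (n : ℝ) ^ 3)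
    (S S' : Finset (Fin n)) (a : Fin n → ℝ) (ha : a ∈ simplex n)
    (h1 : 1 - 4 / 3 * ε ≤ ∑ i ∈ S, a i)
    (h1' : 1 - 4 / 3 * ε ≤ ∑ i ∈ S', a i)
    (h2' : ∀ j ∈ S', (∑ i ∈ S', a i) / S'.card - 2 * ε ≤ a j) : S' ⊆ S := by
  intro j hj
  by_contra hjS
  have hle : a j + ∑ i ∈ S, a i ≤ 1 := by
    rw [← Finset.sum_insert hjS, ← ha.2]
    exact Finset.sum_le_univ_sum_of_nonneg ha.1
  have h3 := h2' j hj
  have hn1 : (1:ℝ) ≤ n := by exact_mod_cast hn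
  have hm : (1:ℝ) ≤ S'.card := by
    exact_mod_cast (Finset.card_pos.mpr ⟨j, hj⟩)
  have hmn : (S'.card : ℝ) ≤ n := by
    exact_mod_cast (by simpa using Finset.card_le_univ S')
  have h4 : (1 - 4 / 3 * ε) / S'.card ≤ 10 / 3 * ε := by
    have : (1 - 4 / 3 * ε) / S'.card ≤ (∑ i ∈ S', a i) / S'.card := by gcongr
    linarith
  rw [div_le_iff₀ (by linarith)] at h4
  rw [le_div_iff₀ (by positivity)] at h
  have h5 : ε * n ≤ ε * (n:ℝ) ^ 3 := by
    have : (n:ℝ) ≤ (n:ℝ) ^ 3 := le_self_pow₀ hn1 (by norm_num)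
    gcongr
  have h6 : ε * S'.card ≤ ε * n := by gcongr
  have h7 : ε * 1 ≤ ε * n := by gcongr
  nlinarith

/-- there is a constant `c > 0` such that for `ε ≤ c/n³` and distinct nonempty
`S, S' ⊆ [n]`, no uniform `T`-sparse `ε`-CCE of the high-precision game for `S` coincides
(as a distribution on `[n] × [n]`) with a uniform `T'`-sparse `ε`-CCE of the one for `S'`. -/
theorem highPrecision_CCEs_distinct :
    ∃ c > (0 : ℝ),
      ∀ (n : ℕ), 1 ≤ n → ∀ ε : ℝ, 0 ≤ ε → ε ≤ c / (n : ℝ) ^ 3 →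
      ∀ S S' : Finset (Fin n), S.Nonempty → S'.Nonempty → S ≠ S' →
      ∀ (T T' : ℕ), 1 ≤ T → 1 ≤ T' →
      ∀ (x y : Fin T → Fin n → ℝ) (x' y' : Fin T' → Fin n → ℝ),
        (∀ t, x t ∈ simplex n) → (∀ t, y t ∈ simplex n) →
        (∀ t, x' t ∈ simplex n) → (∀ t, y' t ∈ simplex n) →
        IsSparseCCE (HPR S) (HPC S) T x y ε →
        IsSparseCCE (HPR S') (HPC S') T' x' y' ε →
        (fun (i j : Fin n) => (1 / (T : ℝ)) * ∑ t, x t i * y t j) ≠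
          (fun (i j : Fin n) => (1 / (T' : ℝ)) * ∑ t, x' t i * y' t j) := by
  refine ⟨1 / 10, by norm_num, ?_⟩
  intro n hn ε hε hεc S S' hS hS' hne T T' hT hT' x y x' y' hx hy hx' hy' h h' heq
  obtain ⟨k0, k1, k2⟩ := hp_key S hS ε T hT x y hx hy h
    (fun i => (1 / (T : ℝ)) * ∑ t, x t i) (fun _ => rfl)
  have hmar : ∀ i, (1 / (T : ℝ)) * ∑ t, x t i = (1 / (T' : ℝ)) * ∑ t, x' t i := by
    intro i
    have e := congrArg (fun f : Fin n → Fin n → ℝ => ∑ j, f i j) heq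
    simp only [← Finset.mul_sum] at e
    rw [Finset.sum_comm, Finset.sum_comm (s := Finset.univ (α := Fin n))] at e
    simp only [← Finset.mul_sum, (hy _).2, (hy' _).2, mul_one] at e
    exact e
  obtain ⟨_, l1, l2⟩ := hp_key S' hS' ε T' hT' x' y' hx' hy' h'
    (fun i => (1 / (T : ℝ)) * ∑ t, x t i) hmar
  exact hne (Finset.Subset.antisymm
    (hp_sub ε hn hε hεc S' S _ k0 l1 k1 k2)
    (hp_sub ε hn hε hεc S S' _ k0 k1 l1 l2))
end
end

section
/- For every n ≥ 1 and every nonempty S ⊆ [n], the high-precision game (R^S, C^S) satisfies: ⟨u(S), R^S y⟩ ≥ 1/2 for every y ∈ Δⁿ, and ⟨x, C^S u(S)⟩ ≥ 1/2 for every x ∈ Δⁿ, where u(S) ∈ Δⁿ is the uniform distribution over S. -/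
open Finset Matrix

noncomputable section

theorem hp_vecMul {n : ℕ} (S : Finset (Fin n)) (hS : S.Nonempty) (j : Fin n) :
    (unif S ᵥ* HPR S) j = 1 / 2 := by
  have hm : (S.card : ℝ) ≠ 0 := by exact_mod_cast hS.card_pos.ne'
  have h : (unif S ᵥ* HPR S) j = ∑ i ∈ S, (S.card : ℝ)⁻¹ *
      (if j ∈ S then (if i = j then 1 else 0) + 1 / 2 - 1 / (S.card : ℝ) else 1 / 2) := by
    rw [← Finset.univ_inter S, ← Finset.sum_ite_mem, Finset.univ_inter]
    simp only [Matrix.vecMul, dotProduct, unif, HPR]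
    refine Finset.sum_congr rfl fun i _ => ?_
    by_cases hi : i ∈ S <;> simp [hi]
  rw [h, ← Finset.mul_sum]
  by_cases hj : j ∈ S
  · simp only [hj, if_true, Finset.sum_sub_distrib, Finset.sum_add_distrib, Finset.sum_ite_eq',
      Finset.sum_const, nsmul_eq_mul]
    field_simp
    ring
  · simp only [hj, if_false, Finset.sum_const, nsmul_eq_mul]
    field_simp

theorem hp_mulVec {n : ℕ} (S : Finset (Fin n)) (hS : S.Nonempty) (i : Fin n) :
    (HPC S *ᵥ unif S) i = 1 / 2 := by
  have hm : (S.card : ℝ) ≠ 0 := by exact_mod_cast hS.card_pos.ne'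
  have h : (HPC S *ᵥ unif S) i = ∑ j ∈ S,
      (if i ∈ S then -(if i = j then 1 else 0) + 1 / 2 + 1 / (S.card : ℝ) else 1 / 2) *
        (S.card : ℝ)⁻¹ := by
    rw [← Finset.univ_inter S, ← Finset.sum_ite_mem, Finset.univ_inter]
    simp only [Matrix.mulVec, dotProduct, unif, HPC]
    refine Finset.sum_congr rfl fun j _ => ?_
    by_cases hj : j ∈ S <;> simp [hj]
  rw [h, ← Finset.sum_mul]
  by_cases hj : i ∈ S
  · simp only [hj, if_true, Finset.sum_neg_distrib, Finset.sum_add_distrib, Finset.sum_ite_eq,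
      Finset.sum_const, nsmul_eq_mul]
    field_simp
    ring
  · simp only [hj, if_false, Finset.sum_const, nsmul_eq_mul]
    field_simp

/-- in the high-precision game, `u(S)` guarantees Player x a utility of at
least `1/2` against any mixed strategy, and `u(S)` guarantees Player y a utility of at least
`1/2` against any mixed strategy. -/
theorem highPrecision_security_strategies {n : ℕ} (hn : 1 ≤ n)
    (S : Finset (Fin n)) (hS : S.Nonempty) :
    (∀ y ∈ simplex n, unif S ⬝ᵥ (HPR S).mulVec y ≥ 1 / 2) ∧
    (∀ x ∈ simplex n, x ⬝ᵥ (HPC S).mulVec (unif S) ≥ 1 / 2) := by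
  constructor
  · intro y hy
    rw [Matrix.dotProduct_mulVec]
    simp only [dotProduct, hp_vecMul S hS]
    rw [← Finset.mul_sum, hy.2]
    norm_num
  · intro x hx
    simp only [dotProduct, hp_mulVec S hS]
    rw [← Finset.sum_mul, hx.2]
    norm_num
end
end

section
/- In the stitched game setting, let k ≥ 12T and let μ = (1/T) ∑_{t=1}^T x^{(t)} ⊗ y^{(t)} be a uniform T-sparse (1/2)-CCE of the 2n×2n stitched game (R', C'). Then for every t ∈ [T], either (x_U^{(t)} ≤ 6T/k and y_U^{(t)} ≤ 6T/k) or (x_U^{(t)} ≥ 1 − 6T/k and y_U^{(t)} ≥ 1 − 6T/k). -/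
open Finset Matrix

noncomputable section

/-- Row player's payoff matrix of the `2n × 2n` stitched game
`R' = [[R, −k·1], [δ·1, R^S]]`. -/
def StR {n : ℕ} (R RS : Matrix (Fin n) (Fin n) ℝ) (δ k : ℝ) :
    Matrix (Fin (2 * n)) (Fin (2 * n)) ℝ := fun i j =>
  if hi : (i : ℕ) < n then
    if hj : (j : ℕ) < n then R ⟨(i : ℕ), hi⟩ ⟨(j : ℕ), hj⟩ else -k
  else
    if (j : ℕ) < n then δ
    else RS ⟨(i : ℕ) - n, by have := i.isLt; omega⟩ ⟨(j : ℕ) - n, by have := j.isLt; omega⟩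

/-- Column player's payoff matrix of the `2n × 2n` stitched game
`C' = [[C, δ·1], [−k·1, C^S]]`. -/
def StC {n : ℕ} (C CS : Matrix (Fin n) (Fin n) ℝ) (δ k : ℝ) :
    Matrix (Fin (2 * n)) (Fin (2 * n)) ℝ := fun i j =>
  if hi : (i : ℕ) < n then
    if hj : (j : ℕ) < n then C ⟨(i : ℕ), hi⟩ ⟨(j : ℕ), hj⟩ else δ
  else
    if (j : ℕ) < n then -k
    else CS ⟨(i : ℕ) - n, by have := i.isLt; omega⟩ ⟨(j : ℕ) - n, by have := j.isLt; omega⟩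

/-- The mass `x_U = ∑_{i=1}^n x_i` that a strategy on `[2n]` places on the first `n`
actions. -/
def lowMass {n : ℕ} (x : Fin (2 * n) → ℝ) : ℝ := ∑ i : Fin n, x (finL i)

lemma lowMass_eq_aux {n : ℕ} (x : Fin (2 * n) → ℝ) :
    lowMass x = ∑ i : Fin (2 * n), x i * (if (i : ℕ) < n then 1 else 0) := by
  have h : n + n = 2 * n := by omega
  rw [← Equiv.sum_comp (finCongr h), Fin.sum_univ_add]
  simp [lowMass, finL]
  rfl

lemma payoff_le_aux {N : ℕ} (M : Matrix (Fin N) (Fin N) ℝ) (x y f g : Fin N → ℝ) (k : ℝ)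
    (hx : x ∈ simplex N) (hy : y ∈ simplex N)
    (hM : ∀ i j, M i j ≤ 1 - k * (f i * g j)) :
    x ⬝ᵥ M.mulVec y ≤ 1 - k * ((∑ i, x i * f i) * (∑ j, y j * g j)) := by
  have e : 1 - k * ((∑ i, x i * f i) * (∑ j, y j * g j))
      = ∑ i, x i * ∑ j, (1 - k * (f i * g j)) * y j := by
    have e1 : (1 : ℝ) = (∑ i, x i) * (∑ j, y j) := by rw [hx.2, hy.2]; norm_num
    conv_lhs => rw [e1]
    rw [Finset.sum_mul_sum, Finset.sum_mul_sum, Finset.mul_sum, ← Finset.sum_sub_distrib]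
    refine Finset.sum_congr rfl fun i _ => ?_
    rw [Finset.mul_sum, Finset.mul_sum, ← Finset.sum_sub_distrib]
    refine Finset.sum_congr rfl fun j _ => ?_
    ring
  rw [e]
  simp only [dotProduct, Matrix.mulVec]
  refine Finset.sum_le_sum fun i _ => mul_le_mul_of_nonneg_left ?_ (hx.1 i)
  exact Finset.sum_le_sum fun j _ => mul_le_mul_of_nonneg_right (hM i j) (hy.1 j)

lemma wsum_ge_aux {N : ℕ} (v y : Fin N → ℝ) (hy : y ∈ simplex N) (hv : ∀ j, -1 ≤ v j) :
    -1 ≤ ∑ j, v j * y j := by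
  calc (-1 : ℝ) = ∑ j, (-1) * y j := by rw [← Finset.mul_sum, hy.2]; norm_num
    _ ≤ _ := Finset.sum_le_sum fun j _ => mul_le_mul_of_nonneg_right (hv j) (hy.1 j)

lemma single_mem_aux {N : ℕ} (a : Fin N) : (Pi.single a 1 : Fin N → ℝ) ∈ simplex N := by
  refine ⟨fun i => ?_, by simp⟩
  by_cases h : i = a
  · subst h; simp
  · simp [h]

/-- averaged bound gives a bound for each term -/
lemma avg_aux {T : ℕ} (hT : 0 < T) (u d a : Fin T → ℝ) (k : ℝ) (hk : 0 < k)
    (h : (1 / (T : ℝ)) * ∑ t, u t ≥ (1 / (T : ℝ)) * ∑ t, d t - 1 / 2)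
    (hd : ∀ t, -1 ≤ d t) (hu : ∀ t, u t ≤ 1 - k * a t) (ha : ∀ t, 0 ≤ a t) (t : Fin T) :
    k * a t ≤ 5 / 2 * T := by
  have hT' : (0 : ℝ) < T := by exact_mod_cast hT
  have h1 : ∑ t, d t - T / 2 ≤ ∑ t, u t := by
    have := mul_le_mul_of_nonneg_left h hT'.le
    field_simp at this
    linarith
  have h2 : -(T : ℝ) ≤ ∑ t, d t := by
    calc -(T : ℝ) = ∑ t : Fin T, (-1 : ℝ) := by simp
      _ ≤ _ := Finset.sum_le_sum fun t _ => hd t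
  have h3 : ∑ t, u t ≤ T - ∑ t, k * a t := by
    calc _ ≤ ∑ t, (1 - k * a t) := Finset.sum_le_sum fun t _ => hu t
      _ = _ := by rw [Finset.sum_sub_distrib]; simp
  have h4 : k * a t ≤ ∑ t, k * a t :=
    Finset.single_le_sum (f := fun t => k * a t)
      (fun s _ => mul_nonneg hk.le (ha s)) (Finset.mem_univ t)
  linarith

lemma dich_aux (p q e : ℝ) (hp0 : 0 ≤ p) (hp1 : p ≤ 1) (hq0 : 0 ≤ q) (hq1 : q ≤ 1)
    (he : e ≤ 1 / 2) (h1 : p * (1 - q) ≤ 5 / 12 * e) (h2 : (1 - p) * q ≤ 5 / 12 * e) :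
    (p ≤ e ∧ q ≤ e) ∨ (1 - e ≤ p ∧ 1 - e ≤ q) := by
  rcases le_total (1 / 2) p with h | h
  · right
    have a : 1 - q ≤ 5 / 6 * e := by nlinarith
    have b : 7 / 12 ≤ q := by linarith
    constructor <;> nlinarith
  · left
    have a : q ≤ 5 / 6 * e := by nlinarith
    have b : q ≤ 5 / 12 := by linarith
    constructor <;> nlinarith

/-- in a `(1/2)`-CCE of the stitched game with `k ≥ 12T`, every product
component places nearly all its mass either on the first `n` actions (for both players) or
on the last `n` actions (for both players). -/
theorem stitched_CCE_dichotomy {n T : ℕ} (hT : 0 < T)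
    (R C RS CS : Matrix (Fin n) (Fin n) ℝ)
    (hR : ∀ i j, |R i j| ≤ 1) (hC : ∀ i j, |C i j| ≤ 1)
    (hRS : ∀ i j, |RS i j| ≤ 1) (hCS : ∀ i j, |CS i j| ≤ 1)
    (δ k : ℝ) (hδ0 : 0 < δ) (hδ1 : δ < 1 / 2) (hk0 : 0 < k)
    (x0 : Fin n → ℝ) (hx0 : x0 ∈ simplex n)
    (hx0R : ∀ y ∈ simplex n, x0 ⬝ᵥ RS.mulVec y ≥ 1 / 2)
    (y0 : Fin n → ℝ) (hy0 : y0 ∈ simplex n)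
    (hy0C : ∀ x ∈ simplex n, x ⬝ᵥ CS.mulVec y0 ≥ 1 / 2)
    (hk : 12 * (T : ℝ) ≤ k)
    (x y : Fin T → Fin (2 * n) → ℝ)
    (hx : ∀ t, x t ∈ simplex (2 * n)) (hy : ∀ t, y t ∈ simplex (2 * n))
    (hCCE : IsSparseCCE (StR R RS δ k) (StC C CS δ k) T x y (1 / 2)) :
    ∀ t, (lowMass (x t) ≤ 6 * (T : ℝ) / k ∧ lowMass (y t) ≤ 6 * (T : ℝ) / k) ∨
      (1 - 6 * (T : ℝ) / k ≤ lowMass (x t) ∧ 1 - 6 * (T : ℝ) / k ≤ lowMass (y t)) := by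
  obtain ⟨hCR, hCC⟩ := hCCE
  have hn : 0 < n := by
    rcases Nat.eq_zero_or_pos n with h | h
    · subst h
      have := hx0.2
      simp at this
    · exact h
  have hT' : (1 : ℝ) ≤ T := by exact_mod_cast hT
  let a : Fin (2 * n) := finR ⟨0, hn⟩
  have ha : ¬ ((a : ℕ) < n) := by simp [a, finR]
  let m : Fin (2 * n) → ℝ := fun i => if (i : ℕ) < n then 1 else 0
  have hm : ∀ z : Fin (2 * n) → ℝ, ∑ i, z i * m i = lowMass z := fun z => (lowMass_eq_aux z).symm
  have hm' : ∀ z ∈ simplex (2 * n), ∑ i, z i * (1 - m i) = 1 - lowMass z := by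
    intro z hz
    simp only [mul_sub, Finset.sum_sub_distrib, mul_one, hm, hz.2]
  have hl0 : ∀ z ∈ simplex (2 * n), 0 ≤ lowMass z := fun z hz =>
    Finset.sum_nonneg fun i _ => hz.1 _
  have hl1 : ∀ z ∈ simplex (2 * n), lowMass z ≤ 1 := by
    intro z hz
    have : 0 ≤ ∑ i, z i * (1 - m i) := Finset.sum_nonneg fun i _ => by
      refine mul_nonneg (hz.1 i) ?_
      simp only [m]; split_ifs <;> norm_num
    rw [hm' z hz] at this
    linarith
  have hA : ∀ t, k * (lowMass (x t) * (1 - lowMass (y t))) ≤ 5 / 2 * T := by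
    refine avg_aux hT _ _ _ k hk0 (hCR _ (single_mem_aux a)) ?_ ?_ ?_
    · intro t
      rw [single_one_dotProduct]
      refine wsum_ge_aux _ _ (hy t) fun j => ?_
      simp only [StR, ha, dite_false]
      split_ifs
      · linarith
      · exact (abs_le.mp (hRS _ _)).1
    · intro t
      rw [← hm (x t), ← hm' _ (hy t)]
      refine payoff_le_aux _ _ _ m (fun j => 1 - m j) k (hx t) (hy t) fun i j => ?_
      simp only [StR, m]
      split_ifs
      · have := (abs_le.mp (hR ⟨i, by assumption⟩ ⟨j, by assumption⟩)).2
        linarith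
      · linarith
      · linarith
      · have := fun i j => (abs_le.mp (hRS i j)).2
        simpa using this _ _
    · intro t
      exact mul_nonneg (hl0 _ (hx t)) (sub_nonneg.mpr (hl1 _ (hy t)))
  have hB : ∀ t, k * ((1 - lowMass (x t)) * lowMass (y t)) ≤ 5 / 2 * T := by
    refine avg_aux hT _ _ _ k hk0 (hCC _ (single_mem_aux a)) ?_ ?_ ?_
    · intro t
      rw [mulVec_single_one, dotProduct_comm]
      refine wsum_ge_aux _ _ (hx t) fun j => ?_
      simp only [StC, ha, dite_false, if_false, Matrix.col_apply]
      split_ifs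
      · linarith
      · exact (abs_le.mp (hCS _ _)).1
    · intro t
      rw [← hm (y t), ← hm' _ (hx t)]
      refine payoff_le_aux _ _ _ (fun j => 1 - m j) m k (hx t) (hy t) fun i j => ?_
      simp only [StC, m]
      split_ifs
      · have := (abs_le.mp (hC ⟨i, by assumption⟩ ⟨j, by assumption⟩)).2
        linarith
      · linarith
      · linarith
      · have := fun i j => (abs_le.mp (hCS i j)).2
        simpa using this _ _
    · intro t
      exact mul_nonneg (sub_nonneg.mpr (hl1 _ (hx t))) (hl0 _ (hy t))
  intro t
  refine dich_aux _ _ _ (hl0 _ (hx t)) (hl1 _ (hx t)) (hl0 _ (hy t)) (hl1 _ (hy t)) ?_ ?_ ?_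
  · rw [div_le_iff₀ hk0]; linarith
  · have := hA t
    rw [← mul_div_assoc, le_div_iff₀ hk0]; linarith
  · have := hB t
    rw [← mul_div_assoc, le_div_iff₀ hk0]; linarith
end
end

section
/- In the stitched game setting, let k ≥ 12T, 0 ≤ ε' ≤ 1/2, and let μ = (1/T) ∑_{t=1}^T x^{(t)} ⊗ y^{(t)} be a uniform T-sparse ε'-CE of the 2n×2n stitched game (R', C'). Define T_U = {t ∈ [T] : x_U^{(t)} ≥ 1 − 6T/k and y_U^{(t)} ≥ 1 − 6T/k}. If T_U ≠ ∅, then μ̂ = (1/|T_U|) ∑_{t ∈ T_U} x̂^{(t)} ⊗ ŷ^{(t)}, where x̂^{(t)} = (x_1^{(t)}, …, x_n^{(t)})/x_U^{(t)} ∈ Δⁿ and ŷ^{(t)} = (y_1^{(t)}, …, y_n^{(t)})/y_U^{(t)} ∈ Δⁿ, is a uniform |T_U|-sparse (ε'·T + 30T²/k)-CE of the n×n game (R, C). -/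
open Finset Matrix

noncomputable section

/-- `μ = (1/|ts|) ∑_{t ∈ ts} x^{(t)} ⊗ y^{(t)}` is a uniform `|ts|`-sparse `ε`-CE of
`(R, C)`. -/
def IsSparseCEOn {n : ℕ} {ι : Type*} [Fintype ι] (R C : Matrix (Fin n) (Fin n) ℝ)
    (ts : Finset ι) (x y : ι → Fin n → ℝ) (ε : ℝ) : Prop :=
  ∀ φx φy : Fin n → Fin n, InPhi φx → InPhi φy →
    (1 / (ts.card : ℝ)) * ∑ t ∈ ts, x t ⬝ᵥ R.mulVec (y t) ≥
      (1 / (ts.card : ℝ)) * ∑ t ∈ ts, devApply φx (x t) ⬝ᵥ R.mulVec (y t) - ε ∧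
    (1 / (ts.card : ℝ)) * ∑ t ∈ ts, x t ⬝ᵥ C.mulVec (y t) ≥
      (1 / (ts.card : ℝ)) * ∑ t ∈ ts, x t ⬝ᵥ C.mulVec (devApply φy (y t)) - ε


lemma aux_dev {n : ℕ} (φ : Fin n → Fin n) (x w : Fin n → ℝ) :
    devApply φ x ⬝ᵥ w = ∑ i, x i * w (φ i) := by
  simp only [devApply, dotProduct, Finset.sum_mul]
  rw [Finset.sum_comm]
  refine Finset.sum_congr rfl fun i _ => ?_
  simp [ite_mul]

lemma aux_split {n : ℕ} (f : Fin (2 * n) → ℝ) :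
    ∑ i, f i = ∑ i : Fin n, f (finL i) + ∑ i : Fin n, f (finR i) := by
  have e : n + n = 2 * n := by omega
  rw [← (finCongr e).sum_comp, Fin.sum_univ_add]
  rfl

lemma aux_LL {n : ℕ} (R RS : Matrix (Fin n) (Fin n) ℝ) (δ k : ℝ) (i j : Fin n) :
    StR R RS δ k (finL i) (finL j) = R i j := by simp [StR, finL]
lemma aux_LR {n : ℕ} (R RS : Matrix (Fin n) (Fin n) ℝ) (δ k : ℝ) (i j : Fin n) :
    StR R RS δ k (finL i) (finR j) = -k := by simp [StR, finL, finR]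
lemma aux_RL {n : ℕ} (R RS : Matrix (Fin n) (Fin n) ℝ) (δ k : ℝ) (i j : Fin n) :
    StR R RS δ k (finR i) (finL j) = δ := by simp [StR, finL, finR]
lemma aux_RR {n : ℕ} (R RS : Matrix (Fin n) (Fin n) ℝ) (δ k : ℝ) (i j : Fin n) :
    StR R RS δ k (finR i) (finR j) = RS i j := by simp [StR, finR]

lemma aux_high {n : ℕ} {x : Fin (2 * n) → ℝ} (hx : x ∈ simplex (2 * n)) :
    ∑ i : Fin n, x (finR i) = 1 - lowMass x := by
  have := hx.2
  rw [aux_split] at this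
  unfold lowMass
  linarith

lemma aux_low0 {n : ℕ} {x : Fin (2 * n) → ℝ} (hx : x ∈ simplex (2 * n)) : 0 ≤ lowMass x :=
  Finset.sum_nonneg fun i _ => hx.1 _

lemma aux_low1 {n : ℕ} {x : Fin (2 * n) → ℝ} (hx : x ∈ simplex (2 * n)) : lowMass x ≤ 1 := by
  have h1 := aux_high hx
  have : 0 ≤ ∑ i : Fin n, x (finR i) := Finset.sum_nonneg fun i _ => hx.1 _
  linarith

lemma aux_mvL {n : ℕ} (R RS : Matrix (Fin n) (Fin n) ℝ) (δ k : ℝ) (i : Fin n)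
    {y : Fin (2 * n) → ℝ} (hy : y ∈ simplex (2 * n)) :
    (StR R RS δ k).mulVec y (finL i) =
      R.mulVec (fun j => y (finL j)) i - k * (1 - lowMass y) := by
  simp only [mulVec, dotProduct]
  rw [aux_split]
  simp only [aux_LL, aux_LR]
  rw [← Finset.mul_sum, aux_high hy]
  ring

lemma aux_mvR {n : ℕ} (R RS : Matrix (Fin n) (Fin n) ℝ) (δ k : ℝ) (i : Fin n)
    (y : Fin (2 * n) → ℝ) :
    (StR R RS δ k).mulVec y (finR i) =
      δ * lowMass y + RS.mulVec (fun j => y (finR j)) i := by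
  simp only [mulVec, dotProduct]
  rw [aux_split]
  simp only [aux_RL, aux_RR]
  rw [← Finset.mul_sum, lowMass]

lemma aux_bd {n : ℕ} (R : Matrix (Fin n) (Fin n) ℝ) (hR : ∀ i j, |R i j| ≤ 1)
    (y : Fin n → ℝ) (hy : ∀ j, 0 ≤ y j) (i : Fin n) : |R.mulVec y i| ≤ ∑ j, y j := by
  simp only [mulVec, dotProduct]
  refine (Finset.abs_sum_le_sum_abs _ _).trans (Finset.sum_le_sum fun j _ => ?_)
  rw [abs_mul, abs_of_nonneg (hy j)]
  exact mul_le_of_le_one_left (hy j) (hR i j)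

lemma aux_bd2 {n : ℕ} (x w : Fin n → ℝ) (c : ℝ) (hx : ∀ j, 0 ≤ x j) (hw : ∀ i, |w i| ≤ c) :
    |∑ i, x i * w i| ≤ (∑ i, x i) * c := by
  rw [Finset.sum_mul]
  refine (Finset.abs_sum_le_sum_abs _ _).trans (Finset.sum_le_sum fun j _ => ?_)
  rw [abs_mul, abs_of_nonneg (hx j)]
  exact mul_le_mul_of_nonneg_left (hw j) (hx j)

lemma aux_mass {n T : ℕ} (hn : 0 < n) (R RS : Matrix (Fin n) (Fin n) ℝ)
    (hR : ∀ i j, |R i j| ≤ 1) (hRS : ∀ i j, |RS i j| ≤ 1)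
    (δ k : ℝ) (hδ0 : 0 < δ) (hk0 : 0 < k) (ε' : ℝ) (hε' : ε' ≤ 1 / 2)
    (x y : Fin T → Fin (2 * n) → ℝ)
    (hx : ∀ t, x t ∈ simplex (2 * n)) (hy : ∀ t, y t ∈ simplex (2 * n))
    (H : ∀ φ : Fin (2 * n) → Fin (2 * n), InPhi φ →
      ∑ t, devApply φ (x t) ⬝ᵥ (StR R RS δ k).mulVec (y t) ≤
        ∑ t, x t ⬝ᵥ (StR R RS δ k).mulVec (y t) + ε' * T) (t : Fin T) :
    k * (lowMass (x t) * (1 - lowMass (y t))) ≤ 3 / 2 * T := by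
  let φ : Fin (2 * n) → Fin (2 * n) := fun i => if (i : ℕ) < n then finR ⟨0, hn⟩ else i
  have hφ : InPhi φ := by
    refine Or.inl ⟨finR ⟨0, hn⟩, finL ⟨n - 1, by omega⟩, fun i => ⟨fun h => ?_, fun h => ?_⟩⟩
    · have : (i : ℕ) ≤ n - 1 := h
      exact if_pos (by omega)
    · have : n - 1 < (i : ℕ) := h
      exact if_neg (by omega)
  have h1 := H φ hφ
  have hL : ∀ i : Fin n, φ (finL i) = finR ⟨0, hn⟩ := fun i => if_pos i.2
  have hR' : ∀ i : Fin n, φ (finR i) = finR i := fun i => if_neg (by simp [finR])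
  have key : ∀ t, k * (lowMass (x t) * (1 - lowMass (y t))) - 1 ≤
      devApply φ (x t) ⬝ᵥ (StR R RS δ k).mulVec (y t)
        - x t ⬝ᵥ (StR R RS δ k).mulVec (y t) := by
    intro t
    rw [aux_dev, dotProduct, aux_split, aux_split]
    simp only [hL, hR', aux_mvL _ _ _ _ _ (hy t), aux_mvR]
    have e : ∀ (w : Fin n → ℝ) (c : ℝ), ∑ i, x t (finL i) * (w i - c) =
        ∑ i, x t (finL i) * w i - (∑ i, x t (finL i)) * c := by
      intro w c
      rw [Finset.sum_mul, ← Finset.sum_sub_distrib]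
      exact Finset.sum_congr rfl fun i _ => by ring
    rw [← Finset.sum_mul, e]
    have b1 := abs_le.1 (aux_bd RS hRS (fun j => y t (finR j)) (fun j => (hy t).1 _) ⟨0, hn⟩)
    have b2 := abs_le.1 (aux_bd2 (fun i => x t (finL i)) _ _ (fun j => (hx t).1 _)
      (aux_bd R hR (fun j => y t (finL j)) (fun j => (hy t).1 _)))
    rw [aux_high (hy t)] at b1
    change _ ∧ _ ≤ lowMass (x t) * lowMass (y t) at b2
    change _ ≤ lowMass (x t) * _ + _ - (_ - lowMass (x t) * _ + _)
    have a0 := aux_low0 (hx t)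
    have a1 := aux_low1 (hx t)
    have c0 := aux_low0 (hy t)
    have e1 := mul_le_mul_of_nonneg_left b1.1 a0
    have e2 : 0 ≤ lowMass (x t) * (δ * lowMass (y t)) := by positivity
    nlinarith [b2.2]
  have h2 : ∑ t, (k * (lowMass (x t) * (1 - lowMass (y t)))) - T ≤ ε' * T := by
    have := Finset.sum_le_sum fun t (_ : t ∈ Finset.univ) => key t
    simp only [Finset.sum_sub_distrib] at this
    simp at this h1 ⊢
    linarith
  have h3 : k * (lowMass (x t) * (1 - lowMass (y t))) ≤
      ∑ t, (k * (lowMass (x t) * (1 - lowMass (y t)))) :=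
    Finset.single_le_sum (f := fun t => k * (lowMass (x t) * (1 - lowMass (y t))))
      (fun t _ => mul_nonneg hk0.le (mul_nonneg (aux_low0 (hx t))
        (sub_nonneg.2 (aux_low1 (hy t))))) (Finset.mem_univ t)
  have : (0 : ℝ) ≤ T := Nat.cast_nonneg _
  nlinarith

lemma aux_out {k T a b : ℝ} (hk0 : 0 < k) (hk : 12 * T ≤ k) (hT : 0 ≤ T)
    (a0 : 0 ≤ a) (a1 : a ≤ 1) (b0 : 0 ≤ b) (b1 : b ≤ 1)
    (h1 : k * (a * (1 - b)) ≤ 3 / 2 * T) (h2 : k * (b * (1 - a)) ≤ 3 / 2 * T)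
    (h : a < 1 - 6 * T / k) : a * b ≤ T / k := by
  have hs : k * (6 * T / k) = 6 * T := by field_simp
  have hq : k * (1 - a) > 6 * T := by nlinarith
  have hb : b ≤ 1 / 4 := by
    by_contra hc
    push Not at hc
    nlinarith [mul_le_mul_of_nonneg_left hc.le (sub_nonneg.2 a1)]
  have ha : k * (a * (3 / 4)) ≤ 3 / 2 * T := by
    nlinarith [mul_nonneg hk0.le a0]
  rw [le_div_iff₀ hk0]
  nlinarith [mul_nonneg hk0.le a0]

lemma aux_row {n T : ℕ} (R RS : Matrix (Fin n) (Fin n) ℝ)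
    (hR : ∀ i j, |R i j| ≤ 1)
    (δ k : ℝ) (hk0 : 0 < k) (hk : 12 * (T : ℝ) ≤ k) (hT : 0 < T)
    (ε' : ℝ) (hε'0 : 0 ≤ ε')
    (x y : Fin T → Fin (2 * n) → ℝ)
    (hx : ∀ t, x t ∈ simplex (2 * n)) (hy : ∀ t, y t ∈ simplex (2 * n))
    (H : ∀ φ : Fin (2 * n) → Fin (2 * n), InPhi φ →
      ∑ t, devApply φ (x t) ⬝ᵥ (StR R RS δ k).mulVec (y t) ≤
        ∑ t, x t ⬝ᵥ (StR R RS δ k).mulVec (y t) + ε' * T)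
    (m1 : ∀ t, k * (lowMass (x t) * (1 - lowMass (y t))) ≤ 3 / 2 * T)
    (m2 : ∀ t, k * (lowMass (y t) * (1 - lowMass (x t))) ≤ 3 / 2 * T)
    (TU : Finset (Fin T))
    (hTU : ∀ t, t ∈ TU ↔
      (1 - 6 * (T : ℝ) / k ≤ lowMass (x t) ∧ 1 - 6 * (T : ℝ) / k ≤ lowMass (y t)))
    (hTUne : TU.Nonempty)
    (xh yh : Fin T → Fin n → ℝ)
    (hxh : ∀ t i, xh t i = x t (finL i) / lowMass (x t))
    (hyh : ∀ t j, yh t j = y t (finL j) / lowMass (y t))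
    (φ : Fin n → Fin n) (hφ : InPhi φ) :
    (1 / (TU.card : ℝ)) * ∑ t ∈ TU, xh t ⬝ᵥ R.mulVec (yh t) ≥
      (1 / (TU.card : ℝ)) * ∑ t ∈ TU, devApply φ (xh t) ⬝ᵥ R.mulVec (yh t)
        - (ε' * (T : ℝ) + 30 * (T : ℝ) ^ 2 / k) := by
  have hT1 : (1 : ℝ) ≤ T := by exact_mod_cast hT
  let ψ : Fin (2 * n) → Fin (2 * n) := fun i =>
    if h : (i : ℕ) < n then finL (φ ⟨i, h⟩) else i
  have hL : ∀ i : Fin n, ψ (finL i) = finL (φ i) := fun i => dif_pos i.2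
  have hR' : ∀ i : Fin n, ψ (finR i) = finR i := fun i => dif_neg (by simp [finR])
  have hψ : InPhi ψ := by
    rcases hφ with ⟨i', i₀, h⟩ | ⟨i₀, h⟩
    · refine Or.inl ⟨finL i', finL i₀, fun i => ⟨fun hi => ?_, fun hi => ?_⟩⟩
      · have h1 : (i : ℕ) ≤ i₀ := hi
        have h2 : (i : ℕ) < n := by omega
        have := (h ⟨i, h2⟩).1 h1
        simp only [ψ, dif_pos h2, this]
      · have h1 : (i₀ : ℕ) < i := hi
        by_cases h2 : (i : ℕ) < n
        · have := (h ⟨i, h2⟩).2 h1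
          simp only [ψ, dif_pos h2, this]
          rfl
        · exact dif_neg h2
    · refine Or.inr ⟨finL i₀, fun i hi => ?_⟩
      by_cases h2 : (i : ℕ) < n
      · have := h ⟨i, h2⟩ (fun hc => hi (by rw [← hc]; rfl))
        simp only [ψ, dif_pos h2, this]
        rfl
      · exact dif_neg h2
  -- the gain on the upper block
  let A : Fin T → ℝ := fun t => ∑ i, x t (finL i) *
    (R.mulVec (fun j => y t (finL j)) (φ i) - R.mulVec (fun j => y t (finL j)) i)
  have hA : ∀ t, devApply ψ (x t) ⬝ᵥ (StR R RS δ k).mulVec (y t)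
        - x t ⬝ᵥ (StR R RS δ k).mulVec (y t) = A t := by
    intro t
    rw [aux_dev, dotProduct, aux_split, aux_split]
    simp only [hL, hR', aux_mvL _ _ _ _ _ (hy t), A]
    rw [add_sub_add_right_eq_sub, ← Finset.sum_sub_distrib]
    refine Finset.sum_congr rfl fun i _ => ?_
    ring
  have hsum : ∑ t, A t ≤ ε' * T := by
    have := H ψ hψ
    simp only [← hA, Finset.sum_sub_distrib]
    linarith
  have hAb : ∀ t, |A t| ≤ lowMass (x t) * (2 * lowMass (y t)) := by
    intro t
    refine aux_bd2 (fun i => x t (finL i)) (fun i => R.mulVec (fun j => y t (finL j)) (φ i)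
      - R.mulVec (fun j => y t (finL j)) i) _ (fun j => (hx t).1 _) (fun i => ?_)
    have b1 := aux_bd R hR (fun j => y t (finL j)) (fun j => (hy t).1 _) (φ i)
    have b2 := aux_bd R hR (fun j => y t (finL j)) (fun j => (hy t).1 _) i
    change _ ≤ lowMass (y t) at b1 b2
    have := abs_sub (R.mulVec (fun j => y t (finL j)) (φ i)) (R.mulVec (fun j => y t (finL j)) i)
    linarith
  have hhalf : 6 * (T : ℝ) / k ≤ 1 / 2 := by
    rw [div_le_iff₀ hk0]; linarith
  let D : Fin T → ℝ := fun t =>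
    devApply φ (xh t) ⬝ᵥ R.mulVec (yh t) - xh t ⬝ᵥ R.mulVec (yh t)
  have hD : ∀ t, D t = A t / (lowMass (x t) * lowMass (y t)) := by
    intro t
    have e1 : yh t = (lowMass (y t))⁻¹ • (fun j => y t (finL j)) := by
      ext j; rw [hyh]; simp [div_eq_inv_mul]
    simp only [D, A, aux_dev]
    rw [dotProduct, ← Finset.sum_sub_distrib, Finset.sum_div]
    refine Finset.sum_congr rfl fun i _ => ?_
    rw [e1, mulVec_smul, hxh]
    simp only [Pi.smul_apply, smul_eq_mul, div_eq_mul_inv, mul_inv]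
    ring
  have hin : ∀ t ∈ TU, D t ≤ A t + 24 * T / k := by
    intro t ht
    obtain ⟨p, q⟩ := (hTU t).1 ht
    have a1 := aux_low1 (hx t)
    have b1 := aux_low1 (hy t)
    have hpos : 0 < lowMass (x t) * lowMass (y t) := mul_pos (by linarith) (by linarith)
    have hb := hAb t
    have hDA : A t = D t * (lowMass (x t) * lowMass (y t)) := by
      rw [hD, div_mul_cancel₀ _ hpos.ne']
    have hD2 : D t ≤ 2 := by
      rw [hD, div_le_iff₀ hpos]
      linarith [le_abs_self (A t)]
    have hprod : 1 - lowMass (x t) * lowMass (y t) ≤ 2 * (6 * T / k) := by nlinarith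
    have hprod0 : 0 ≤ 1 - lowMass (x t) * lowMass (y t) := by nlinarith
    have : (24 : ℝ) * T / k = 2 * (2 * (6 * T / k)) := by ring
    rw [this]
    nlinarith
  have hout : ∀ t ∈ TUᶜ, -A t ≤ 2 * (T / k) := by
    intro t ht
    rw [Finset.mem_compl, hTU, not_and_or, not_le, not_le] at ht
    have a0 := aux_low0 (hx t)
    have b0 := aux_low0 (hy t)
    have a1 := aux_low1 (hx t)
    have b1 := aux_low1 (hy t)
    have : lowMass (x t) * lowMass (y t) ≤ T / k := by
      rcases ht with ht | ht
      · exact aux_out hk0 hk (by linarith) a0 a1 b0 b1 (m1 t) (m2 t) ht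
      · rw [mul_comm]
        exact aux_out hk0 hk (by linarith) b0 b1 a0 a1 (m2 t) (m1 t) ht
    have := hAb t
    have := neg_abs_le (A t)
    linarith
  have s1 := Finset.sum_le_sum hin
  have s2 := Finset.sum_le_sum hout
  have s3 := Finset.sum_add_sum_compl TU A
  simp only [Finset.sum_add_distrib, Finset.sum_const, nsmul_eq_mul, Finset.sum_neg_distrib] at s1 s2
  have hc1 : (1 : ℝ) ≤ TU.card := by exact_mod_cast hTUne.card_pos
  have hcc : ((TUᶜ).card : ℝ) ≤ T := by
    have := Finset.card_le_univ TUᶜ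
    rw [Fintype.card_fin] at this
    exact_mod_cast this
  have hTk : 0 ≤ (T : ℝ) / k := by positivity
  have hTT : (T : ℝ) / k ≤ T * (T / k) := by nlinarith
  have hmain : ∑ t ∈ TU, D t ≤ TU.card * (ε' * (T : ℝ) + 30 * (T : ℝ) ^ 2 / k) := by
    have r1 : (24 : ℝ) * T / k = 24 * (T / k) := by ring
    have r2 : (30 : ℝ) * (T : ℝ) ^ 2 / k = 30 * (T * (T / k)) := by ring
    rw [r1] at s1
    rw [r2]
    have q1 : ((TUᶜ).card : ℝ) * (2 * (T / k)) ≤ T * (2 * (T / k)) :=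
      mul_le_mul_of_nonneg_right hcc (by linarith)
    have q2 : (TU.card : ℝ) * (24 * (T / k)) ≤ TU.card * (24 * (T * (T / k))) :=
      mul_le_mul_of_nonneg_left (by linarith) (by linarith)
    have q3 : 1 * (ε' * T + 2 * (T * (T / k))) ≤ TU.card * (ε' * T + 2 * (T * (T / k))) :=
      mul_le_mul_of_nonneg_right hc1 (by positivity)
    have q4 : 0 ≤ (TU.card : ℝ) * (T * (T / k)) := by positivity
    nlinarith
  simp only [D, Finset.sum_sub_distrib] at hmain
  have hc0 : (0 : ℝ) < TU.card := by linarith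
  have := mul_le_mul_of_nonneg_left hmain (one_div_nonneg.2 hc0.le)
  rw [← mul_assoc, one_div_mul_cancel hc0.ne', one_mul, mul_sub] at this
  linarith

lemma aux_StC {n : ℕ} (C CS : Matrix (Fin n) (Fin n) ℝ) (δ k : ℝ) :
    StC C CS δ k = (StR Cᵀ CSᵀ δ k)ᵀ := by
  ext i j
  simp only [StC, StR, transpose_apply]
  split_ifs <;> rfl

lemma aux_tr {n : ℕ} (M : Matrix (Fin n) (Fin n) ℝ) (x y : Fin n → ℝ) :
    x ⬝ᵥ M.mulVec y = y ⬝ᵥ Mᵀ.mulVec x := by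
  rw [dotProduct_mulVec, ← mulVec_transpose, dotProduct_comm]

lemma aux_simplex {n : ℕ} {x : Fin (2 * n) → ℝ} (hx : x ∈ simplex (2 * n))
    (h : 0 < lowMass x) {z : Fin n → ℝ} (hz : ∀ i, z i = x (finL i) / lowMass x) :
    z ∈ simplex n := by
  refine ⟨fun i => ?_, ?_⟩
  · rw [hz]; exact div_nonneg (hx.1 _) h.le
  · simp only [hz]
    rw [← Finset.sum_div]
    exact div_self h.ne'

/-- in an `ε'`-CE of the stitched game with `k ≥ 12T`, if the set `T_U` of
components placing mass at least `1 − 6T/k` on the first `n` actions (for both players) is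
nonempty, then conditioning on `T_U` and renormalizing onto the first `n` actions yields a
uniform `|T_U|`-sparse `(ε'·T + 30T²/k)`-CE of `(R, C)`. -/
theorem stitched_CE_induces_CE {n T : ℕ} (hT : 0 < T)
    (R C RS CS : Matrix (Fin n) (Fin n) ℝ)
    (hR : ∀ i j, |R i j| ≤ 1) (hC : ∀ i j, |C i j| ≤ 1)
    (hRS : ∀ i j, |RS i j| ≤ 1) (hCS : ∀ i j, |CS i j| ≤ 1)
    (δ k : ℝ) (hδ0 : 0 < δ) (hδ1 : δ < 1 / 2) (hk0 : 0 < k)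
    (x0 : Fin n → ℝ) (hx0 : x0 ∈ simplex n)
    (hx0R : ∀ y ∈ simplex n, x0 ⬝ᵥ RS.mulVec y ≥ 1 / 2)
    (y0 : Fin n → ℝ) (hy0 : y0 ∈ simplex n)
    (hy0C : ∀ x ∈ simplex n, x ⬝ᵥ CS.mulVec y0 ≥ 1 / 2)
    (hk : 12 * (T : ℝ) ≤ k)
    (ε' : ℝ) (hε'0 : 0 ≤ ε') (hε' : ε' ≤ 1 / 2)
    (x y : Fin T → Fin (2 * n) → ℝ)
    (hx : ∀ t, x t ∈ simplex (2 * n)) (hy : ∀ t, y t ∈ simplex (2 * n))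
    (hCE : IsSparseCE (StR R RS δ k) (StC C CS δ k) T x y ε')
    (TU : Finset (Fin T))
    (hTU : ∀ t, t ∈ TU ↔
      (1 - 6 * (T : ℝ) / k ≤ lowMass (x t) ∧ 1 - 6 * (T : ℝ) / k ≤ lowMass (y t)))
    (hTUne : TU.Nonempty)
    (xh yh : Fin T → Fin n → ℝ)
    (hxh : ∀ t i, xh t i = x t (finL i) / lowMass (x t))
    (hyh : ∀ t j, yh t j = y t (finL j) / lowMass (y t)) :
    (∀ t ∈ TU, xh t ∈ simplex n) ∧ (∀ t ∈ TU, yh t ∈ simplex n) ∧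
    IsSparseCEOn R C TU xh yh (ε' * (T : ℝ) + 30 * (T : ℝ) ^ 2 / k) := by
  have hT1 : (1 : ℝ) ≤ T := by exact_mod_cast hT
  have hn : 0 < n := by
    rcases Nat.eq_zero_or_pos n with h | h
    · subst h
      have := hx0.2
      simp at this
    · exact h
  have hhalf : 6 * (T : ℝ) / k ≤ 1 / 2 := by
    rw [div_le_iff₀ hk0]; linarith
  have hid : InPhi (id : Fin (2 * n) → Fin (2 * n)) :=
    Or.inr ⟨⟨0, by omega⟩, fun i _ => rfl⟩
  have conv : ∀ a b : ℝ, (1 / (T : ℝ)) * a ≥ (1 / (T : ℝ)) * b - ε' → b ≤ a + ε' * T := by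
    intro a b h
    have h2 := mul_le_mul_of_nonneg_right h (by linarith : (0 : ℝ) ≤ T)
    have e : ∀ c : ℝ, (1 / (T : ℝ)) * c * T = c := fun c => by field_simp
    rw [sub_mul, e, e] at h2
    linarith
  have Hx : ∀ φ : Fin (2 * n) → Fin (2 * n), InPhi φ →
      ∑ t, devApply φ (x t) ⬝ᵥ (StR R RS δ k).mulVec (y t) ≤
        ∑ t, x t ⬝ᵥ (StR R RS δ k).mulVec (y t) + ε' * T :=
    fun φ h => conv _ _ (hCE φ id h hid).1
  have Hy : ∀ φ : Fin (2 * n) → Fin (2 * n), InPhi φ →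
      ∑ t, devApply φ (y t) ⬝ᵥ (StR Cᵀ CSᵀ δ k).mulVec (x t) ≤
        ∑ t, y t ⬝ᵥ (StR Cᵀ CSᵀ δ k).mulVec (x t) + ε' * T := by
    intro φ h
    have := conv _ _ (hCE id φ hid h).2
    rw [aux_StC] at this
    simpa only [aux_tr (StR Cᵀ CSᵀ δ k)ᵀ, transpose_transpose] using this
  have hC' : ∀ i j, |Cᵀ i j| ≤ 1 := fun i j => hC j i
  have m1 := aux_mass hn R RS hR hRS δ k hδ0 hk0 ε' hε' x y hx hy Hx
  have m2 := aux_mass hn Cᵀ CSᵀ hC' (fun i j => hCS j i) δ k hδ0 hk0 ε' hε' y x hy hx Hy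
  refine ⟨fun t ht => aux_simplex (hx t) (by linarith [((hTU t).1 ht).1]) (hxh t),
    fun t ht => aux_simplex (hy t) (by linarith [((hTU t).1 ht).2]) (hyh t), ?_⟩
  intro φx φy hφx hφy
  refine ⟨aux_row R RS hR δ k hk0 hk hT ε' hε'0 x y hx hy Hx m1 m2 TU hTU hTUne xh yh hxh hyh
    φx hφx, ?_⟩
  have := aux_row Cᵀ CSᵀ hC' δ k hk0 hk hT ε' hε'0 y x hy hx Hy m2 m1 TU
    (fun t => (hTU t).trans and_comm) hTUne yh xh hyh hxh φy hφy
  simpa only [aux_tr Cᵀ, transpose_transpose] using this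
end
end
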